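/- Conjugate Cauchy–Riemann derivative of E₁: for every ζ = (ζ₁,ζ₂) ∈ ℂ² and every x ∈ ℝ³, D̄⁽ˡ⁾E₁(x,ζ) = −2·i·ζ_vec·E₁(x,ζ). Consequently, if w ∈ ℂ satisfies w ≠ 0 and w² = ζ₁² + ζ₂², then the function E₂(x,ζ) := (1/(2w))·D̄⁽ˡ⁾E₁(x,ζ) equals −(i·ζ_vec/w)·E₁(x,ζ). -/

import Mathlib

open scoped Quaternion

noncomputable section

/-- The basis element `e₁` of the complex Clifford algebra `ℂ₍₂₎ = ℍ[ℂ]`. -/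
def e1 : ℍ[ℂ] := ⟨0, 1, 0, 0⟩

/-- The basis element `e₂` of the complex Clifford algebra `ℂ₍₂₎ = ℍ[ℂ]`. -/
def e2 : ℍ[ℂ] := ⟨0, 0, 1, 0⟩

/-- `ζ_vec = ζ₁ e₁ + ζ₂ e₂`. -/
def zvec (ζ : ℂ × ℂ) : ℍ[ℂ] := ⟨0, ζ.1, ζ.2, 0⟩

/-- The exponential power series `Σ_{k≥0} (1/k!) Aᵏ` in `ℂ₍₂₎`, computed componentwise. -/
def qexp (A : ℍ[ℂ]) : ℍ[ℂ] :=
  ⟨∑' k : ℕ, (k.factorial : ℂ)⁻¹ * (A ^ k).re,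
   ∑' k : ℕ, (k.factorial : ℂ)⁻¹ * (A ^ k).imI,
   ∑' k : ℕ, (k.factorial : ℂ)⁻¹ * (A ^ k).imJ,
   ∑' k : ℕ, (k.factorial : ℂ)⁻¹ * (A ^ k).imK⟩

/-- `E₁(x,ζ) = exp(i(x₁ζ₁ + x₂ζ₂)e₀ − i x₀ ζ_vec)`. -/
def E1 (x : Fin 3 → ℝ) (ζ : ℂ × ℂ) : ℍ[ℂ] :=
  qexp ((Complex.I * ((x 1 : ℂ) * ζ.1 + (x 2 : ℂ) * ζ.2)) • (1 : ℍ[ℂ])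
    - (Complex.I * (x 0 : ℂ)) • zvec ζ)

/-- Componentwise partial derivative of a `ℂ₍₂₎`-valued function in the `j`-th direction. -/
def pdQ (j : Fin 3) (f : (Fin 3 → ℝ) → ℍ[ℂ]) (x : Fin 3 → ℝ) : ℍ[ℂ] :=
  ⟨fderiv ℝ (fun y => (f y).re) x (Pi.single j 1),
   fderiv ℝ (fun y => (f y).imI) x (Pi.single j 1),
   fderiv ℝ (fun y => (f y).imJ) x (Pi.single j 1),
   fderiv ℝ (fun y => (f y).imK) x (Pi.single j 1)⟩

/-- Componentwise differentiability of a `ℂ₍₂₎`-valued function. -/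
def QDiffAt (f : (Fin 3 → ℝ) → ℍ[ℂ]) (x : Fin 3 → ℝ) : Prop :=
  DifferentiableAt ℝ (fun y => (f y).re) x ∧ DifferentiableAt ℝ (fun y => (f y).imI) x ∧
  DifferentiableAt ℝ (fun y => (f y).imJ) x ∧ DifferentiableAt ℝ (fun y => (f y).imK) x

/-- The left Cauchy–Riemann operator `D⁽ˡ⁾f = ∂₀f + e₁ ∂₁f + e₂ ∂₂f`. -/
def Dl (f : (Fin 3 → ℝ) → ℍ[ℂ]) (x : Fin 3 → ℝ) : ℍ[ℂ] :=
  pdQ 0 f x + e1 * pdQ 1 f x + e2 * pdQ 2 f x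

/-- The right Cauchy–Riemann operator `D⁽ʳ⁾f = ∂₀f + (∂₁f) e₁ + (∂₂f) e₂`. -/
def Dr (f : (Fin 3 → ℝ) → ℍ[ℂ]) (x : Fin 3 → ℝ) : ℍ[ℂ] :=
  pdQ 0 f x + pdQ 1 f x * e1 + pdQ 2 f x * e2

/-- The conjugate left Cauchy–Riemann operator `D̄⁽ˡ⁾f = ∂₀f − e₁ ∂₁f − e₂ ∂₂f`. -/
def Dbar (f : (Fin 3 → ℝ) → ℍ[ℂ]) (x : Fin 3 → ℝ) : ℍ[ℂ] :=
  pdQ 0 f x - e1 * pdQ 1 f x - e2 * pdQ 2 f x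

lemma hasSum_inv_factorial_mul_pow (z : ℂ) :
    HasSum (fun k : ℕ => (k.factorial : ℂ)⁻¹ * z ^ k) (Complex.exp z) := by
  have h := NormedSpace.exp_series_hasSum_exp' (𝕂 := ℂ) z
  rw [← Complex.exp_eq_exp_ℂ] at h
  simpa only [smul_eq_mul] using h

lemma hasSum_inv_factorial_mul_natCast_mul_pow (z : ℂ) :
    HasSum (fun k : ℕ => (k.factorial : ℂ)⁻¹ * (k * z ^ (k - 1))) (Complex.exp z) := by
  rw [← hasSum_nat_add_iff' 1, Finset.sum_range_one, Nat.cast_zero, zero_mul, mul_zero, sub_zero]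
  refine (hasSum_inv_factorial_mul_pow z).congr_fun fun k => ?_
  rw [Nat.factorial_succ, Nat.add_sub_cancel]
  have h1 : ((k + 1 : ℕ) : ℂ) ≠ 0 := Nat.cast_ne_zero.mpr k.succ_ne_zero
  have h2 : (k.factorial : ℂ) ≠ 0 := Nat.cast_ne_zero.mpr k.factorial_ne_zero
  push_cast at h1 ⊢
  field_simp

@[simp] lemma zvec_re (ζ : ℂ × ℂ) : (zvec ζ).re = 0 := rfl

@[simp] lemma zvec_imI (ζ : ℂ × ℂ) : (zvec ζ).imI = ζ.1 := rfl

@[simp] lemma zvec_imJ (ζ : ℂ × ℂ) : (zvec ζ).imJ = ζ.2 := rfl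

@[simp] lemma zvec_imK (ζ : ℂ × ℂ) : (zvec ζ).imK = 0 := rfl

lemma e1_eq_zvec : e1 = zvec (1, 0) := rfl

lemma e2_eq_zvec : e2 = zvec (0, 1) := rfl

/-- If the powers of `A` lie in the span of `1` and `zvec ζ`, then so does `qexp A`. -/
lemma qexp_eq_of_hasSum {A : ℍ[ℂ]} {ζ : ℂ × ℂ} {u v : ℕ → ℂ} {s t : ℂ}
    (hA : ∀ k, A ^ k = u k • (1 : ℍ[ℂ]) + v k • zvec ζ)
    (hu : HasSum (fun k : ℕ => (k.factorial : ℂ)⁻¹ * u k) s)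
    (hv : HasSum (fun k : ℕ => (k.factorial : ℂ)⁻¹ * v k) t) :
    qexp A = s • (1 : ℍ[ℂ]) + t • zvec ζ := by
  have hI := (hv.mul_right ζ.1).tsum_eq
  have hJ := (hv.mul_right ζ.2).tsum_eq
  simp only [mul_assoc] at hI hJ
  ext <;> simp [qexp, hA, hu.tsum_eq, hI, hJ]

/-- The powers of `a + b ζ_vec`, given by a pair of sequences satisfying the recursion coming from
`ζ_vec² = -(ζ₁² + ζ₂²)`. -/
lemma smul_one_add_smul_zvec_pow {ζ : ℂ × ℂ} {a b : ℂ} {u v : ℕ → ℂ} (hu₀ : u 0 = 1)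
    (hv₀ : v 0 = 0) (hu : ∀ k, u (k + 1) = u k * a - v k * b * (ζ.1 ^ 2 + ζ.2 ^ 2))
    (hv : ∀ k, v (k + 1) = u k * b + v k * a) (k : ℕ) :
    (a • (1 : ℍ[ℂ]) + b • zvec ζ) ^ k = u k • (1 : ℍ[ℂ]) + v k • zvec ζ := by
  induction k with
  | zero => ext <;> simp [hu₀, hv₀]
  | succ k ih =>
    rw [pow_succ, ih, hu, hv]
    ext <;> simp <;> ring

/-- The exponential of `a + b ζ_vec` is `e^a (C b + S b ζ_vec)`, where `S` has derivative `C`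
and `C` has derivative `-(ζ₁² + ζ₂²) S`. -/
lemma exists_qexp_eq (ζ : ℂ × ℂ) :
    ∃ C S : ℂ → ℂ, (∀ b, HasDerivAt C (-(ζ.1 ^ 2 + ζ.2 ^ 2) * S b) b) ∧
      (∀ b, HasDerivAt S (C b) b) ∧
      ∀ a b, qexp (a • (1 : ℍ[ℂ]) + b • zvec ζ) =
        (Complex.exp a * C b) • (1 : ℍ[ℂ]) + (Complex.exp a * S b) • zvec ζ := by
  obtain ⟨w, hw⟩ := IsAlgClosed.exists_pow_nat_eq (ζ.1 ^ 2 + ζ.2 ^ 2) two_pos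
  rcases eq_or_ne w 0 with rfl | hw₀
  · have hq : ζ.1 ^ 2 + ζ.2 ^ 2 = 0 := by rw [← hw]; ring
    refine ⟨fun _ => 1, fun b => b, fun b => ?_, fun b => hasDerivAt_id b, fun a b => ?_⟩
    · simpa [hq] using hasDerivAt_const b (1 : ℂ)
    · refine qexp_eq_of_hasSum (smul_one_add_smul_zvec_pow (u := fun k => a ^ k)
        (v := fun k => k * a ^ (k - 1) * b) (by simp) (by simp) ?_ ?_) ?_ ?_
      · intro k
        rw [hq, mul_zero, sub_zero, pow_succ]
      · rintro (_ | k)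
        · simp
        · simp only [Nat.add_sub_cancel, pow_succ]
          push_cast
          ring
      · simpa using hasSum_inv_factorial_mul_pow a
      · simpa only [← mul_assoc] using (hasSum_inv_factorial_mul_natCast_mul_pow a).mul_right b
  · set m := Complex.I * w with hm
    have hm₀ : m ≠ 0 := mul_ne_zero Complex.I_ne_zero hw₀
    have hq : ζ.1 ^ 2 + ζ.2 ^ 2 = -m ^ 2 := by rw [hm, mul_pow, Complex.I_sq, hw]; ring
    have hd₁ (b : ℂ) := ((hasDerivAt_id' b).mul_const m).cexp
    have hd₂ (b : ℂ) := ((hasDerivAt_id' b).fun_neg.mul_const m).cexp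
    refine ⟨fun b => (Complex.exp (b * m) + Complex.exp (-b * m)) / 2,
      fun b => (Complex.exp (b * m) - Complex.exp (-b * m)) / (2 * m),
      fun b => (((hd₁ b).add (hd₂ b)).div_const 2).congr_deriv ?_,
      fun b => (((hd₁ b).sub (hd₂ b)).div_const (2 * m)).congr_deriv ?_, fun a b => ?_⟩
    · rw [hq]
      field_simp
      ring
    · field_simp
      ring
    · have h₁ := hasSum_inv_factorial_mul_pow (a + b * m)
      have h₂ := hasSum_inv_factorial_mul_pow (a + -b * m)
      rw [Complex.exp_add] at h₁ h₂
      refine qexp_eq_of_hasSum (smul_one_add_smul_zvec_pow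
        (u := fun k => ((a + b * m) ^ k + (a + -b * m) ^ k) / 2)
        (v := fun k => ((a + b * m) ^ k - (a + -b * m) ^ k) / (2 * m)) (by simp) (by simp)
        ?_ ?_) ?_ ?_
      · intro k
        rw [hq]
        field_simp
        ring
      · intro k
        field_simp
        ring
      · simpa only [mul_add, mul_div_assoc, add_div] using (h₁.add h₂).div_const 2
      · simpa only [mul_sub, mul_div_assoc, sub_div] using (h₁.sub h₂).div_const (2 * m)

lemma fderiv_cexp_mul_apply (ζ : ℂ × ℂ) {h : ℂ → ℂ} {h' : ℂ} (x v : Fin 3 → ℝ)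
    (hh : HasDerivAt h h' (-(Complex.I * x 0))) :
    fderiv ℝ (fun y : Fin 3 → ℝ =>
        Complex.exp (Complex.I * (y 1 * ζ.1 + y 2 * ζ.2)) * h (-(Complex.I * y 0))) x v =
      Complex.exp (Complex.I * (x 1 * ζ.1 + x 2 * ζ.2)) *
        (Complex.I * (v 1 * ζ.1 + v 2 * ζ.2) * h (-(Complex.I * x 0)) -
          Complex.I * v 0 * h') := by
  have hc (i : Fin 3) : HasFDerivAt (fun y : Fin 3 → ℝ => (y i : ℂ))
      (Complex.ofRealCLM.comp (ContinuousLinearMap.proj (R := ℝ) (φ := fun _ => ℝ) i)) x :=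
    (Complex.ofRealCLM.comp
      (ContinuousLinearMap.proj (R := ℝ) (φ := fun _ : Fin 3 => ℝ) i)).hasFDerivAt
  have hexp := ((((hc 1).mul_const ζ.1).add ((hc 2).mul_const ζ.2)).const_mul Complex.I).cexp
  have hcomp := (hh.hasFDerivAt.restrictScalars ℝ).comp x ((hc 0).const_mul Complex.I).neg
  refine (congrArg (fun L => L v) (hexp.mul hcomp).fderiv).trans ?_
  simp
  ring

/-- Conjugate Cauchy–Riemann derivative of `E₁`: `D̄⁽ˡ⁾E₁(x,ζ) = −2 i ζ_vec E₁(x,ζ)`;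
consequently, if `w ≠ 0` and `w² = ζ₁² + ζ₂²`, then
`E₂(x,ζ) := (1/(2w)) D̄⁽ˡ⁾E₁(x,ζ)` equals `−(i ζ_vec / w) E₁(x,ζ)`. -/
theorem Dbar_E1 (ζ : ℂ × ℂ) (x : Fin 3 → ℝ) :
    Dbar (fun y => E1 y ζ) x = (-(2 * Complex.I)) • (zvec ζ * E1 x ζ) ∧
    ∀ w : ℂ, w ≠ 0 → w ^ 2 = ζ.1 ^ 2 + ζ.2 ^ 2 →
      (1 / (2 * w)) • Dbar (fun y => E1 y ζ) x =
        (-(Complex.I / w)) • (zvec ζ * E1 x ζ) := by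
  have hDbar : Dbar (fun y => E1 y ζ) x = (-(2 * Complex.I)) • (zvec ζ * E1 x ζ) := by
    obtain ⟨C, S, hC, hS, hexp⟩ := exists_qexp_eq ζ
    have hE (y : Fin 3 → ℝ) : E1 y ζ = _ :=
      (congrArg qexp (by ext <;> simp)).trans
        (hexp (Complex.I * (y 1 * ζ.1 + y 2 * ζ.2)) (-(Complex.I * y 0)))
    have hre (v : Fin 3 → ℝ) := fderiv_cexp_mul_apply ζ x v (hC _)
    have him (c : ℂ) (v : Fin 3 → ℝ) := fderiv_cexp_mul_apply ζ x v ((hS _).mul_const c)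
    simp only [← mul_assoc] at him
    have hpd (j : Fin 3) : pdQ j (fun y => E1 y ζ) x =
        (Complex.I * ((Pi.single j 1 : Fin 3 → ℝ) 1 * ζ.1 + (Pi.single j 1 : Fin 3 → ℝ) 2 * ζ.2)) •
          E1 x ζ - (Complex.I * (Pi.single j 1 : Fin 3 → ℝ) 0) • (zvec ζ * E1 x ζ) := by
      ext <;> simp [pdQ, hE, hre, him, -mul_eq_zero, -zero_eq_mul] <;> ring
    rw [Dbar, hpd, hpd, hpd, e1_eq_zvec, e2_eq_zvec]
    ext <;> simp <;> ring
  refine ⟨hDbar, fun w hw _ => ?_⟩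
  rw [hDbar, smul_smul]
  congr 1
  field_simp
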